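/- arXiv:2012.00880 — 3 statements merged into one kernel-verified Lean document; each statement's English description precedes it below -/
import Mathlib

section
/- Let X and K be nonempty finite types, let G be a nonempty finite universal family of hash functions g : X → K, and let p : X → ℝ be a probability mass function. If Σ_x p(x)² ≤ δ for some δ ≥ 0, then Σ_{g ∈ G} Σ_{κ ∈ K} | p_g(κ)/|G| − 1/(|G|·|K|) | ≤ √(|K| · δ). In particular, if |K| = |A|^k and δ = |A|^{−h₊} for a real base |A| > 1, the joint distribution of the extracted key and the hash function is within |A|^{(k−h₊)/2} in total variation of the uniform-times-uniform distribution (paper's Lemma 'classical bipartite': the leftover hash lemma). -/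
open Finset

/-- Classical leftover hash lemma (paper's Lemma "classical bipartite"):
for a universal family `G` of hash functions `g : X → K` and a probability mass
function `p` on `X` with collision probability `∑ p² ≤ δ`, the joint distribution
`(κ,g) ↦ p_g(κ)/|G|` of key and hash is within `√(|K|·δ)` of uniform in total
variation; in particular for `|K| = A^k` and `δ = A^{−hplus}` the bound is
`A^{(k−hplus)/2}`. -/
theorem classical_leftover_hash {X K : Type*}
    [Fintype X] [Nonempty X] [DecidableEq X] [Fintype K] [Nonempty K] [DecidableEq K]
    (G : Finset (X → K)) (hG : G.Nonempty)
    (huniv : ∀ x x' : X, x ≠ x' →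
      ((G.filter (fun g => g x = g x')).card : ℝ) ≤ (G.card : ℝ) / (Fintype.card K))
    (p : X → ℝ) (hp : ∀ x, 0 ≤ p x) (hp1 : ∑ x, p x = 1)
    (δ : ℝ) (hδ : 0 ≤ δ) (hcol : ∑ x, (p x) ^ 2 ≤ δ) :
    (∑ g ∈ G, ∑ κ : K,
        |(∑ x ∈ Finset.univ.filter (fun x => g x = κ), p x) / (G.card : ℝ) -
          1 / ((G.card : ℝ) * (Fintype.card K : ℝ))|)
      ≤ Real.sqrt ((Fintype.card K : ℝ) * δ) ∧
    ∀ (A k hplus : ℝ), 1 < A → (Fintype.card K : ℝ) = A ^ k → δ = A ^ (-hplus) →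
      Real.sqrt ((Fintype.card K : ℝ) * δ) = A ^ ((k - hplus) / 2) := by
  have hN : (0 : ℝ) < G.card := by exact_mod_cast hG.card_pos
  have hM : (0 : ℝ) < Fintype.card K := by exact_mod_cast Fintype.card_pos
  refine ⟨?_, ?_⟩
  · set q : (X → K) → K → ℝ := fun g κ => ∑ x ∈ Finset.univ.filter (fun x => g x = κ), p x with hq
    have hq1 : ∀ g, ∑ κ, q g κ = 1 := by
      intro g
      rw [← hp1]
      exact Finset.sum_fiberwise Finset.univ g p
    have hq2 : ∀ g : X → K, ∑ κ, (q g κ) ^ 2 =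
        ∑ x, ∑ x', (if g x = g x' then p x * p x' else 0) := by
      intro g
      have h1 : ∀ κ, (q g κ) ^ 2 =
          ∑ x ∈ Finset.univ.filter (fun x => g x = κ), p x * q g (g x) := by
        intro κ
        rw [sq]
        conv_lhs => rw [hq]
        simp only []
        rw [Finset.sum_mul]
        refine Finset.sum_congr rfl fun x hx => ?_
        rw [(Finset.mem_filter.mp hx).2]
      rw [Finset.sum_congr rfl fun κ _ => h1 κ,
        Finset.sum_fiberwise Finset.univ g (fun x => p x * q g (g x))]
      refine Finset.sum_congr rfl fun x _ => ?_
      simp only [hq]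
      rw [Finset.mul_sum, Finset.sum_filter]
      refine Finset.sum_congr rfl fun x' _ => ?_
      simp only [eq_comm]
    have hcoll : ∑ g ∈ G, ∑ κ, (q g κ) ^ 2 ≤
        (G.card : ℝ) * δ + (G.card : ℝ) / (Fintype.card K) := by
      have hsw : ∑ g ∈ G, ∑ κ, (q g κ) ^ 2 = ∑ x, ∑ x', (p x * p x') *
          ((G.filter (fun g => g x = g x')).card : ℝ) := by
        rw [Finset.sum_congr rfl fun g _ => hq2 g, Finset.sum_comm]
        refine Finset.sum_congr rfl fun x _ => ?_
        rw [Finset.sum_comm]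
        refine Finset.sum_congr rfl fun x' _ => ?_
        rw [← Finset.sum_filter, Finset.sum_const, nsmul_eq_mul, mul_comm]
      have hb : ∀ x x' : X, (p x * p x') * ((G.filter (fun g => g x = g x')).card : ℝ) ≤
          (if x = x' then (G.card : ℝ) * (p x) ^ 2 else 0) +
            p x * p x' * ((G.card : ℝ) / (Fintype.card K)) := by
        intro x x'
        have hpp : 0 ≤ p x * p x' := mul_nonneg (hp x) (hp x')
        by_cases h : x = x'
        · subst h
          have : 0 ≤ p x * p x * ((G.card : ℝ) / (Fintype.card K)) := by positivity
          simp only [Finset.filter_true, if_true]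
          nlinarith
        · rw [if_neg h, zero_add]
          exact mul_le_mul_of_nonneg_left (huniv x x' h) hpp
      rw [hsw]
      refine (Finset.sum_le_sum fun x _ => Finset.sum_le_sum fun x' _ => hb x x').trans ?_
      simp only [Finset.sum_add_distrib, Finset.sum_ite_eq, Finset.mem_univ, if_true,
        ← Finset.sum_mul, ← Finset.mul_sum, hp1, mul_one, one_mul]
      have := mul_le_mul_of_nonneg_left hcol hN.le
      linarith
    apply Real.le_sqrt_of_sq_le
    have hcs := sq_sum_le_card_mul_sum_sq (s := G ×ˢ (Finset.univ : Finset K))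
      (f := fun z => |q z.1 z.2 / (G.card : ℝ) - 1 / ((G.card : ℝ) * (Fintype.card K : ℝ))|)
    simp only [Finset.sum_product, sq_abs, Finset.card_product, Finset.card_univ,
      Nat.cast_mul] at hcs
    refine hcs.trans ?_
    have he : ∑ g ∈ G, ∑ κ, (q g κ / (G.card : ℝ) -
        1 / ((G.card : ℝ) * (Fintype.card K : ℝ))) ^ 2 =
        (∑ g ∈ G, ∑ κ, (q g κ) ^ 2 - (G.card : ℝ) / (Fintype.card K)) / (G.card : ℝ) ^ 2 := by
      have h1 : ∀ g, ∑ κ, (q g κ / (G.card : ℝ) -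
          1 / ((G.card : ℝ) * (Fintype.card K : ℝ))) ^ 2 =
          (∑ κ, (q g κ) ^ 2 - 1 / (Fintype.card K)) / (G.card : ℝ) ^ 2 := by
        intro g
        have h2 : ∀ κ, (q g κ / (G.card : ℝ) -
          1 / ((G.card : ℝ) * (Fintype.card K : ℝ))) ^ 2 =
          ((q g κ) ^ 2 - q g κ * (2 / (Fintype.card K)) + 1 / (Fintype.card K : ℝ) ^ 2)
            / (G.card : ℝ) ^ 2 := by
          intro κ
          field_simp
          ring
        rw [Finset.sum_congr rfl fun κ _ => h2 κ, ← Finset.sum_div, Finset.sum_add_distrib,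
          Finset.sum_sub_distrib, ← Finset.sum_mul, hq1, Finset.sum_const, Finset.card_univ,
          nsmul_eq_mul]
        field_simp
        ring
      rw [Finset.sum_congr rfl fun g _ => h1 g, ← Finset.sum_div, Finset.sum_sub_distrib,
        Finset.sum_const, nsmul_eq_mul, mul_one_div]
    rw [he]
    calc _ ≤ (G.card : ℝ) * (Fintype.card K) * (((G.card : ℝ) * δ) / (G.card : ℝ) ^ 2) := by
          gcongr
          linarith
      _ = _ := by
          field_simp
  · intro A k hplus hA hk hd
    have hA0 : 0 < A := by linarith
    rw [hk, hd, ← Real.rpow_add hA0, Real.sqrt_eq_rpow, ← Real.rpow_mul hA0.le]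
    congr 1
    ring
end

section
/- Let X and K be nonempty finite types, let G be a nonempty finite universal family of hash functions g : X → K, and let p : X → ℝ be a probability mass function. Then the collision sum satisfies Σ_{g ∈ G} Σ_{κ ∈ K} (p_g(κ))² ≤ |G|/|K| + |G| · Σ_x p(x)²; equivalently, the collision probability of the joint distribution (κ,g) ↦ p_g(κ)/|G| is at most 1/(|G|·|K|) + (Σ_x p(x)²)/|G| (collision-probability bound in the proof of the paper's Lemma 'classical bipartite'). -/
open Finset

/-- Collision-probability bound for a universal hash family
(from the proof of the paper's Lemma "classical bipartite"):
`∑_{g ∈ G} ∑_{κ} p_g(κ)² ≤ |G|/|K| + |G| ∑_x p(x)²`. -/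
theorem collision_probability_bound {X K : Type*}
    [Fintype X] [Nonempty X] [DecidableEq X] [Fintype K] [Nonempty K] [DecidableEq K]
    (G : Finset (X → K)) (hG : G.Nonempty)
    (huniv : ∀ x x' : X, x ≠ x' →
      ((G.filter (fun g => g x = g x')).card : ℝ) ≤ (G.card : ℝ) / (Fintype.card K))
    (p : X → ℝ) (hp : ∀ x, 0 ≤ p x) (hp1 : ∑ x, p x = 1) :
    ∑ g ∈ G, ∑ κ : K, (∑ x ∈ Finset.univ.filter (fun x => g x = κ), p x) ^ 2
      ≤ (G.card : ℝ) / (Fintype.card K : ℝ) + (G.card : ℝ) * ∑ x, (p x) ^ 2 := by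
  have h1 : ∀ g : X → K,
      ∑ κ : K, (∑ x ∈ Finset.univ.filter (fun x => g x = κ), p x) ^ 2
        = ∑ x, ∑ x', if g x = g x' then p x * p x' else 0 := by
    intro g
    have h2 : ∀ κ : K, (∑ x ∈ Finset.univ.filter (fun x => g x = κ), p x) ^ 2
        = ∑ x, ∑ x', if g x = κ then (if g x' = κ then p x * p x' else 0) else 0 := by
      intro κ
      rw [sq, Finset.sum_filter, Finset.sum_mul_sum]
      refine Finset.sum_congr rfl fun x _ => Finset.sum_congr rfl fun x' _ => ?_
      split_ifs <;> simp
    simp_rw [h2]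
    rw [Finset.sum_comm]
    refine Finset.sum_congr rfl fun x _ => ?_
    rw [Finset.sum_comm]
    refine Finset.sum_congr rfl fun x' _ => ?_
    rw [Finset.sum_ite_eq]
    simp [eq_comm]
  have h3 : ∑ g ∈ G, ∑ κ : K, (∑ x ∈ Finset.univ.filter (fun x => g x = κ), p x) ^ 2
      = ∑ x, ∑ x', ((G.filter (fun g => g x = g x')).card : ℝ) * (p x * p x') := by
    simp_rw [h1]
    rw [Finset.sum_comm]
    refine Finset.sum_congr rfl fun x _ => ?_
    rw [Finset.sum_comm]
    refine Finset.sum_congr rfl fun x' _ => ?_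
    rw [← Finset.sum_filter, Finset.sum_const, nsmul_eq_mul]
  have h4 : (G.card : ℝ) / (Fintype.card K : ℝ) + (G.card : ℝ) * ∑ x, (p x) ^ 2
      = ∑ x, ∑ x', ((G.card : ℝ) / (Fintype.card K : ℝ) * (p x * p x')
          + if x = x' then (G.card : ℝ) * (p x * p x') else 0) := by
    simp_rw [Finset.sum_add_distrib, ← Finset.mul_sum, hp1]
    simp [← Finset.mul_sum, hp1, sq]
  rw [h3, h4]
  refine Finset.sum_le_sum fun x _ => Finset.sum_le_sum fun x' _ => ?_
  have hpp : 0 ≤ p x * p x' := mul_nonneg (hp x) (hp x')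
  by_cases hx : x = x'
  · subst hx
    have : 0 ≤ (G.card : ℝ) / (Fintype.card K : ℝ) * (p x * p x) := by positivity
    simpa using this
  · simpa [hx] using mul_le_mul_of_nonneg_right (huniv x x' hx) hpp
end

section
/- Let X be a nonempty finite type, let A ≥ 2 be a natural number, let k be a natural number, let K = (Fin A)^k (so |K| = A^k), let G be a nonempty finite universal family of hash functions g : X → K, and let p : X → ℝ be a probability mass function with Σ_x p(x)² ≤ A^{−h₊} for a real h₊. Then for every ε ∈ (0,1], if (k : ℝ) ≤ h₊ + 2·(log ε)/(log A), then Σ_{g ∈ G} Σ_{κ ∈ K} | p_g(κ)/|G| − 1/(|G|·|K|) | ≤ ε; i.e., any key length k up to ⌊h₊ + 2 log_A ε⌋ yields an ε-uniform extracted key (paper's Corollary 'diagonal bipartite' on the maximum extractable key length). -/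
open Finset

theorem lhl_aux {X K : Type*} [Fintype X] [DecidableEq X] [Fintype K] [DecidableEq K]
    (G : Finset (X → K)) (N M : ℝ) (hN : (G.card : ℝ) = N) (hM : (Fintype.card K : ℝ) = M)
    (hN0 : 0 < N) (hM0 : 0 < M)
    (huniv : ∀ x x' : X, x ≠ x' → ((G.filter (fun g => g x = g x')).card : ℝ) ≤ N / M)
    (p : X → ℝ) (hp : ∀ x, 0 ≤ p x) (hp1 : ∑ x, p x = 1) :
    (∑ g ∈ G, ∑ κ : K,
        |(∑ x ∈ Finset.univ.filter (fun x => g x = κ), p x) / N - 1 / (N * M)|) ^ 2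
      ≤ M * ∑ x, (p x) ^ 2 := by
  have hq1 : ∀ g : X → K, ∑ κ : K, (∑ x ∈ Finset.univ.filter (fun x => g x = κ), p x) = 1 := by
    intro g
    rw [Finset.sum_fiberwise, hp1]
  have hq2 : ∀ g : X → K, ∑ κ : K, (∑ x ∈ Finset.univ.filter (fun x => g x = κ), p x) ^ 2
      = ∑ x, ∑ x', p x * p x' * (if g x = g x' then 1 else 0) := by
    intro g
    have h1 : ∀ κ : K, (∑ x ∈ Finset.univ.filter (fun x => g x = κ), p x) ^ 2
        = ∑ x ∈ Finset.univ.filter (fun x => g x = κ),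
            ∑ x', p x * p x' * (if g x = g x' then 1 else 0) := by
      intro κ
      rw [sq, Finset.sum_mul]
      refine Finset.sum_congr rfl fun x hx => ?_
      have hx' : g x = κ := (Finset.mem_filter.1 hx).2
      rw [Finset.mul_sum, Finset.sum_filter]
      refine Finset.sum_congr rfl fun y _ => ?_
      rw [hx']
      by_cases h : g y = κ
      · simp [h]
      · simp [h, Ne.symm h]
    simp_rw [h1]
    rw [Finset.sum_fiberwise]
  have hcoll : ∑ g ∈ G, ∑ κ : K, (∑ x ∈ Finset.univ.filter (fun x => g x = κ), p x) ^ 2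
      ≤ N * ∑ x, (p x) ^ 2 + N / M := by
    simp_rw [hq2]
    rw [Finset.sum_comm]
    have hb : ∀ x, ∑ g ∈ G, ∑ x', p x * p x' * (if g x = g x' then (1:ℝ) else 0)
        ≤ ∑ x', ((if x = x' then N * p x ^ 2 else 0) + N / M * (p x * p x')) := by
      intro x
      rw [Finset.sum_comm]
      refine Finset.sum_le_sum fun y _ => ?_
      rw [← Finset.mul_sum, Finset.sum_boole]
      have hpp := mul_nonneg (hp x) (hp y)
      by_cases h : x = y
      · subst h
        have : 0 ≤ N / M * (p x * p x) := by positivity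
        simp only [Finset.filter_true, if_true, hN]
        nlinarith
      · have := mul_le_mul_of_nonneg_left (huniv x y h) hpp
        simp only [h, if_false]
        linarith
    refine (Finset.sum_le_sum fun x _ => hb x).trans (le_of_eq ?_)
    simp only [Finset.sum_add_distrib, Finset.sum_ite_eq, Finset.mem_univ, if_true,
      ← Finset.mul_sum, hp1, mul_one]
  have hcs : (∑ g ∈ G, ∑ κ : K,
        |(∑ x ∈ Finset.univ.filter (fun x => g x = κ), p x) / N - 1 / (N * M)|) ^ 2
      ≤ N * M * ∑ g ∈ G, ∑ κ : K,
        ((∑ x ∈ Finset.univ.filter (fun x => g x = κ), p x) / N - 1 / (N * M)) ^ 2 := by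
    rw [← Finset.sum_product', ← Finset.sum_product']
    refine sq_sum_le_card_mul_sum_sq.trans (le_of_eq ?_)
    simp [Finset.card_product, hN, hM, sq_abs]
  have hin : ∀ g : X → K, ∑ κ : K,
        ((∑ x ∈ Finset.univ.filter (fun x => g x = κ), p x) / N - 1 / (N * M)) ^ 2
      = (∑ κ : K, (∑ x ∈ Finset.univ.filter (fun x => g x = κ), p x) ^ 2) / N ^ 2
        - 1 / (N ^ 2 * M) := by
    intro g
    have : ∀ a : ℝ, (a / N - 1 / (N * M)) ^ 2
        = 1 / N ^ 2 * a ^ 2 - 2 / (N ^ 2 * M) * a + 1 / (N * M) ^ 2 := by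
      intro a; field_simp
      try ring
    simp_rw [this]
    rw [Finset.sum_add_distrib, Finset.sum_sub_distrib, ← Finset.mul_sum, ← Finset.mul_sum, hq1]
    simp only [Finset.sum_const, Finset.card_univ, nsmul_eq_mul, hM]
    field_simp
    ring
  refine hcs.trans ?_
  simp_rw [hin]
  rw [Finset.sum_sub_distrib, ← Finset.sum_div]
  simp only [Finset.sum_const, nsmul_eq_mul, hN]
  have h2 := mul_le_mul_of_nonneg_left hcoll (show 0 ≤ M / N by positivity)
  have e1 : M / N * (N * ∑ x, p x ^ 2 + N / M) = M * ∑ x, p x ^ 2 + 1 := by field_simp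
  rw [e1] at h2
  have e2 : ∀ T : ℝ, N * M * (T / N ^ 2 - N * (1 / (N ^ 2 * M))) = M / N * T - 1 := by
    intro T; field_simp
  rw [e2]
  linarith

/-- Maximum extractable key length (paper's Corollary "diagonal bipartite"):
with keys in `K = (Fin A)^k` (so `|K| = A^k`), a universal hash family `G`, and a
source with collision probability `∑ p² ≤ A^{−h₊}`, any key length
`k ≤ h₊ + 2·log ε / log A` yields an `ε`-uniform extracted key. -/
theorem max_extractable_key_length {X : Type*}
    [Fintype X] [Nonempty X] [DecidableEq X]
    (A : ℕ) (hA : 2 ≤ A) (k : ℕ)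
    (G : Finset (X → (Fin k → Fin A))) (hG : G.Nonempty)
    (huniv : ∀ x x' : X, x ≠ x' →
      ((G.filter (fun g => g x = g x')).card : ℝ) ≤
        (G.card : ℝ) / (Fintype.card (Fin k → Fin A)))
    (p : X → ℝ) (hp : ∀ x, 0 ≤ p x) (hp1 : ∑ x, p x = 1)
    (hplus : ℝ) (hcol : ∑ x, (p x) ^ 2 ≤ (A : ℝ) ^ (-hplus))
    (ε : ℝ) (hε : ε ∈ Set.Ioc (0 : ℝ) 1)
    (hk : (k : ℝ) ≤ hplus + 2 * Real.log ε / Real.log A) :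
    ∑ g ∈ G, ∑ κ : Fin k → Fin A,
        |(∑ x ∈ Finset.univ.filter (fun x => g x = κ), p x) / (G.card : ℝ) -
          1 / ((G.card : ℝ) * (Fintype.card (Fin k → Fin A) : ℝ))|
      ≤ ε := by
  obtain ⟨hε0, hε1⟩ := hε
  have hA1 : (1 : ℝ) < A := by exact_mod_cast hA
  have hA0 : (0 : ℝ) < A := by linarith
  have hlog : 0 < Real.log A := Real.log_pos hA1
  have hM : (Fintype.card (Fin k → Fin A) : ℝ) = (A : ℝ) ^ k := by simp
  have hM0 : (0 : ℝ) < (Fintype.card (Fin k → Fin A) : ℝ) := by rw [hM]; positivity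
  have hN0 : (0 : ℝ) < (G.card : ℝ) := by exact_mod_cast hG.card_pos
  have key := lhl_aux G _ _ rfl rfl hN0 hM0 huniv p hp hp1
  refine le_of_abs_le (abs_le_of_sq_le_sq (key.trans ?_) hε0.le)
  refine (mul_le_mul_of_nonneg_left hcol hM0.le).trans ?_
  rw [hM, ← Real.rpow_natCast, ← Real.rpow_add hA0, Real.rpow_def_of_pos hA0]
  have h3 : Real.log A * ((k : ℝ) + -hplus) ≤ 2 * Real.log ε := by
    have : (k : ℝ) + -hplus ≤ 2 * Real.log ε / Real.log A := by linarith
    rw [le_div_iff₀ hlog] at this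
    linarith
  calc _ ≤ Real.exp (2 * Real.log ε) := Real.exp_le_exp.2 h3
    _ = ε ^ 2 := by
      rw [two_mul, Real.exp_add, Real.exp_log hε0, sq]
end
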